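/- Let g be a continuous Riemannian metric on ℝ² with finite total area A, and let γ be a piecewise C¹ simple closed curve in ℝ² with interior region Ω_γ (the union of the bounded connected components of the complement of the image of γ). Suppose: the planar isoperimetric inequality 4π·|Ω_γ| ≤ L_e(γ)² holds, where |Ω_γ| is the Lebesgue area of Ω_γ and L_e(γ) the Euclidean length of γ; g(x) ≥ λ·Id as quadratic forms for all x in the image of γ; and g(x) ≤ Λ·Id as quadratic forms for all x ∈ Ω_γ, where Λ ≥ λ > 0 are constants. Then L_g(γ) ≥ 2·√(π·(λ/Λ))·√(A_in(γ)), and consequently I(γ) ≥ 2·√(π·(λ/Λ))·A_in(γ)^{-1/2}. -/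

import Mathlib

open MeasureTheory Set Real

noncomputable section

abbrev E2 := EuclideanSpace ℝ (Fin 2)

/-- The quadratic form associated to a 2×2 matrix. -/
def qf (M : Matrix (Fin 2) (Fin 2) ℝ) (v : E2) : ℝ :=
  ∑ i, ∑ j, M i j * v i * v j

/-- A continuous Riemannian metric on ℝ²: a continuous field of symmetric
positive definite 2×2 matrices. -/
def IsRiemMetric (g : E2 → Matrix (Fin 2) (Fin 2) ℝ) : Prop :=
  Continuous g ∧ (∀ x, (g x).IsSymm) ∧ ∀ x, ∀ v : E2, v ≠ 0 → 0 < qf (g x) v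

/-- A piecewise C¹ curve in ℝ²: continuous on `[a,b]` and differentiable
outside a finite set. -/
structure PC1Curve where
  a : ℝ
  b : ℝ
  hab : a < b
  toFun : ℝ → E2
  cont : ContinuousOn toFun (Icc a b)
  sm : ∃ s : Finset ℝ, ∀ t ∈ Icc a b, t ∉ s → DifferentiableAt ℝ toFun t

def PC1Curve.IsSimpleClosed (c : PC1Curve) : Prop :=
  c.toFun c.a = c.toFun c.b ∧ InjOn c.toFun (Ico c.a c.b)

def PC1Curve.image (c : PC1Curve) : Set E2 := c.toFun '' (Icc c.a c.b)

/-- Union of the bounded connected components of the complement of the image. -/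
def PC1Curve.interiorRegion (c : PC1Curve) : Set E2 :=
  {x | x ∉ c.image ∧ Bornology.IsBounded (connectedComponentIn c.imageᶜ x)}

/-- Length of a curve with respect to the metric `g`. -/
def Lg (g : E2 → Matrix (Fin 2) (Fin 2) ℝ) (c : PC1Curve) : ℝ :=
  ∫ t in c.a..c.b, Real.sqrt (qf (g (c.toFun t)) (deriv c.toFun t))

/-- Euclidean length of a curve. -/
def Le (c : PC1Curve) : ℝ :=
  ∫ t in c.a..c.b, ‖deriv c.toFun t‖

/-- Area density `√(det g)` of the metric `g`. -/
def areaDensity (g : E2 → Matrix (Fin 2) (Fin 2) ℝ) (x : E2) : ℝ :=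
  Real.sqrt ((g x).det)

/-- Total area of ℝ² with respect to `g`. -/
def totalArea (g : E2 → Matrix (Fin 2) (Fin 2) ℝ) : ℝ :=
  ∫ x, areaDensity g x

/-- Area inside a closed curve with respect to `g`. -/
def Ain (g : E2 → Matrix (Fin 2) (Fin 2) ℝ) (c : PC1Curve) : ℝ :=
  ∫ x in c.interiorRegion, areaDensity g x

/-- Area outside a closed curve with respect to `g`. -/
def Aout (g : E2 → Matrix (Fin 2) (Fin 2) ℝ) (c : PC1Curve) : ℝ :=
  totalArea g - Ain g c

/-- The isoperimetric ratio `I(γ)`. -/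
def Iratio (g : E2 → Matrix (Fin 2) (Fin 2) ℝ) (c : PC1Curve) : ℝ :=
  Lg g c * (1 / Ain g c + 1 / Aout g c)

/-- The isoperimetric constant `I_g`: infimum of `I(γ)` over piecewise C¹
simple closed curves. -/
def Ig (g : E2 → Matrix (Fin 2) (Fin 2) ℝ) : ℝ :=
  sInf {r | ∃ c : PC1Curve, c.IsSimpleClosed ∧ Iratio g c = r}


/-- The quadratic form of `M` is bounded by the sum of the absolute values of its entries. -/
lemma qf_le_sum_abs (M : Matrix (Fin 2) (Fin 2) ℝ) (v : E2) :
    qf M v ≤ (∑ i, ∑ j, |M i j|) * ‖v‖ ^ 2 := by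
  unfold qf
  rw [Finset.sum_mul]
  refine Finset.sum_le_sum fun i _ => ?_
  rw [Finset.sum_mul]
  refine Finset.sum_le_sum fun j _ => ?_
  have hi : |v i| ≤ ‖v‖ := PiLp.norm_apply_le v i
  have hj : |v j| ≤ ‖v‖ := PiLp.norm_apply_le v j
  calc M i j * v i * v j ≤ |M i j * v i * v j| := le_abs_self _
    _ = |M i j| * (|v i| * |v j|) := by rw [abs_mul, abs_mul, mul_assoc]
    _ ≤ |M i j| * (‖v‖ * ‖v‖) := by gcongr
    _ = |M i j| * ‖v‖ ^ 2 := by rw [sq]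

/-- If a symmetric form lies between `0` and `Λ·Id`, then `√(det M) ≤ Λ`. -/
lemma sqrt_det_le_of_qf_le {M : Matrix (Fin 2) (Fin 2) ℝ} (hM : M.IsSymm)
    (hpos : ∀ v, 0 ≤ qf M v) {Lam : ℝ} (hLam : 0 ≤ Lam)
    (h : ∀ v : E2, qf M v ≤ Lam * ‖v‖ ^ 2) : √M.det ≤ Lam := by
  have hdiag : ∀ i, qf M (EuclideanSpace.single i 1) = M i i := by
    intro i
    fin_cases i <;> simp [qf]
  have hle : ∀ i, M i i ≤ Lam := fun i => by
    simpa [hdiag] using h (EuclideanSpace.single i 1)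
  have hnn : ∀ i, 0 ≤ M i i := fun i => hdiag i ▸ hpos _
  refine Real.sqrt_le_iff.2 ⟨hLam, ?_⟩
  rw [Matrix.det_fin_two, hM.apply 0 1]
  nlinarith [mul_le_mul (hle 0) (hle 1) (hnn 1) hLam, sq_nonneg (M 0 1)]

lemma PC1Curve.isCompact_image (c : PC1Curve) : IsCompact c.image :=
  isCompact_Icc.image_of_continuousOn c.cont

/-- The interior region of a curve is bounded. -/
lemma PC1Curve.isBounded_interiorRegion (c : PC1Curve) :
    Bornology.IsBounded c.interiorRegion := by
  obtain ⟨R, hR⟩ := c.isCompact_image.isBounded.exists_norm_le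
  refine isBounded_iff_forall_norm_le.2 ⟨max R 0, fun x hx => ?_⟩
  by_contra! hlt
  obtain ⟨hRx, hx0⟩ := max_lt_iff.1 hlt
  have hray : (fun t : ℝ => t • x) '' Ici 1 ⊆ connectedComponentIn c.imageᶜ x := by
    refine IsPreconnected.subset_connectedComponentIn
      (isPreconnected_Ici.image _ (by fun_prop)) ⟨1, self_mem_Ici, one_smul _ _⟩ ?_
    rintro _ ⟨t, ht, rfl⟩ hmem
    have h1 := hR _ hmem
    rw [norm_smul, Real.norm_of_nonneg (zero_le_one.trans ht)] at h1
    nlinarith [mem_Ici.1 ht]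
  obtain ⟨K, hK⟩ := hx.2.exists_norm_le
  have hmem := hK _ (hray ⟨1 + |K| / ‖x‖, mem_Ici.2 (le_add_of_nonneg_right (by positivity)), rfl⟩)
  rw [norm_smul, Real.norm_of_nonneg (by positivity), add_mul, one_mul,
    div_mul_cancel₀ _ hx0.ne'] at hmem
  linarith [le_abs_self K]

lemma Lg_nonneg (g : E2 → Matrix (Fin 2) (Fin 2) ℝ) (c : PC1Curve) : 0 ≤ Lg g c :=
  intervalIntegral.integral_nonneg c.hab.le fun _ _ => Real.sqrt_nonneg _

lemma Ain_nonneg (g : E2 → Matrix (Fin 2) (Fin 2) ℝ) (c : PC1Curve) : 0 ≤ Ain g c :=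
  integral_nonneg fun _ => Real.sqrt_nonneg _

lemma Aout_nonneg {g : E2 → Matrix (Fin 2) (Fin 2) ℝ} (hA : Integrable (areaDensity g))
    (c : PC1Curve) : 0 ≤ Aout g c :=
  sub_nonneg.2 (setIntegral_le_integral hA (.of_forall fun _ => Real.sqrt_nonneg _))

/-- If the Euclidean speed is integrable, so is the speed with respect to a continuous metric. -/
lemma intervalIntegrable_sqrt_qf {g : E2 → Matrix (Fin 2) (Fin 2) ℝ} (hg : Continuous g)
    (c : PC1Curve)
    (h : IntervalIntegrable (fun t => ‖deriv c.toFun t‖) volume c.a c.b) :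
    IntervalIntegrable (fun t => √(qf (g (c.toFun t)) (deriv c.toFun t))) volume c.a c.b := by
  have hgc (i j : Fin 2) : Continuous fun x => g x i j := by fun_prop
  obtain ⟨S, hS⟩ := c.isCompact_image.bddAbove_image
    (f := fun x => ∑ i, ∑ j, |g x i j|) (by fun_prop)
  have hmeas : AEStronglyMeasurable (fun t => √(qf (g (c.toFun t)) (deriv c.toFun t)))
      (volume.restrict (Ioc c.a c.b)) := by
    have hd (i : Fin 2) : Measurable fun t => deriv c.toFun t i :=
      (EuclideanSpace.proj (𝕜 := ℝ) i : E2 →L[ℝ] ℝ).measurable.comp (measurable_deriv c.toFun)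
    have hm (i j : Fin 2) : AEMeasurable (fun t => g (c.toFun t) i j)
        (volume.restrict (Ioc c.a c.b)) :=
      (((hgc i j).comp_continuousOn c.cont).mono Ioc_subset_Icc_self).aemeasurable
        measurableSet_Ioc
    refine AEMeasurable.aestronglyMeasurable (AEMeasurable.sqrt ?_)
    exact Finset.aemeasurable_fun_sum _ fun i _ => Finset.aemeasurable_fun_sum _ fun j _ =>
      ((hm i j).mul (hd i).aemeasurable).mul (hd j).aemeasurable
  rw [intervalIntegrable_iff_integrableOn_Ioc_of_le c.hab.le] at h ⊢
  refine (h.const_mul √S).mono' hmeas ?_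
  filter_upwards [ae_restrict_mem measurableSet_Ioc] with t ht
  rw [Real.norm_of_nonneg (Real.sqrt_nonneg _), ← Real.sqrt_sq (norm_nonneg (deriv c.toFun t)),
    ← Real.sqrt_mul' _ (sq_nonneg _)]
  refine Real.sqrt_le_sqrt ((qf_le_sum_abs _ _).trans ?_)
  gcongr
  exact hS ⟨_, ⟨t, Ioc_subset_Icc_self ht, rfl⟩, rfl⟩

/-- If `g ≥ λ·Id` along a curve, its `g`-length is at least `√λ` times its Euclidean length. -/
lemma sqrt_mul_Le_le_Lg {g : E2 → Matrix (Fin 2) (Fin 2) ℝ} (hg : Continuous g)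
    (c : PC1Curve) {lam : ℝ}
    (hlower : ∀ x ∈ c.image, ∀ v : E2, lam * ‖v‖ ^ 2 ≤ qf (g x) v) :
    √lam * Le c ≤ Lg g c := by
  by_cases h : IntervalIntegrable (fun t => ‖deriv c.toFun t‖) volume c.a c.b
  · rw [Le, ← intervalIntegral.integral_const_mul]
    refine intervalIntegral.integral_mono_on c.hab.le (h.const_mul _)
      (intervalIntegrable_sqrt_qf hg c h) fun t ht => ?_
    rw [← Real.sqrt_sq (norm_nonneg (deriv c.toFun t)), ← Real.sqrt_mul' _ (sq_nonneg _)]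
    exact Real.sqrt_le_sqrt (hlower _ ⟨t, ht, rfl⟩ _)
  · rw [Le, intervalIntegral.integral_undef h, mul_zero]
    exact Lg_nonneg g c

/-- If `g ≤ Λ·Id` on the interior region, the `g`-area inside is at most `Λ` times the
Lebesgue area. -/
lemma Ain_le_mul_volume {g : E2 → Matrix (Fin 2) (Fin 2) ℝ} (hg : IsRiemMetric g)
    (c : PC1Curve) {Lam : ℝ} (hLam : 0 ≤ Lam)
    (hupper : ∀ x ∈ c.interiorRegion, ∀ v : E2, qf (g x) v ≤ Lam * ‖v‖ ^ 2) :
    Ain g c ≤ Lam * (volume c.interiorRegion).toReal := by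
  have hpos (x v) : 0 ≤ qf (g x) v := by
    rcases eq_or_ne v 0 with rfl | hv
    · simp [qf]
    · exact (hg.2.2 x v hv).le
  have hbound : ∀ x ∈ c.interiorRegion, ‖areaDensity g x‖ ≤ Lam := fun x hx => by
    rw [areaDensity, Real.norm_of_nonneg (Real.sqrt_nonneg _)]
    exact sqrt_det_le_of_qf_le (hg.2.1 x) (hpos x) hLam (hupper x hx)
  exact (Real.le_norm_self _).trans (norm_setIntegral_le_of_norm_le_const
    c.isBounded_interiorRegion.measure_lt_top hbound)

/-- If the planar isoperimetric inequality holds for `γ`, `g ≥ λ·Id` on the image of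
`γ` and `g ≤ Λ·Id` on its interior region, then
`L_g(γ) ≥ 2√(π λ/Λ) √(A_in(γ))` and hence `I(γ) ≥ 2√(π λ/Λ) A_in(γ)^{-1/2}`. -/
theorem length_lower_bound_via_inner_area
    (g : E2 → Matrix (Fin 2) (Fin 2) ℝ) (hg : IsRiemMetric g)
    (hA : Integrable (areaDensity g))
    (c : PC1Curve) (hc : c.IsSimpleClosed)
    (hisop : 4 * Real.pi * (volume c.interiorRegion).toReal ≤ (Le c) ^ 2)
    (lam Lam : ℝ) (hlam : 0 < lam) (hlamLam : lam ≤ Lam)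
    (hlower : ∀ x ∈ c.image, ∀ v : E2, lam * ‖v‖ ^ 2 ≤ qf (g x) v)
    (hupper : ∀ x ∈ c.interiorRegion, ∀ v : E2, qf (g x) v ≤ Lam * ‖v‖ ^ 2) :
    2 * Real.sqrt (Real.pi * (lam / Lam)) * Real.sqrt (Ain g c) ≤ Lg g c ∧
      2 * Real.sqrt (Real.pi * (lam / Lam)) / Real.sqrt (Ain g c) ≤ Iratio g c := by
  have hLam : 0 < Lam := hlam.trans_le hlamLam
  have hL := Lg_nonneg g c
  have hin := Ain_nonneg g c
  have hlen : lam * Le c ^ 2 ≤ Lg g c ^ 2 := by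
    have hLe : 0 ≤ Le c := intervalIntegral.integral_nonneg c.hab.le fun _ _ => norm_nonneg _
    have h := pow_le_pow_left₀ (by positivity) (sqrt_mul_Le_le_Lg hg.1 c hlower) 2
    rwa [mul_pow, Real.sq_sqrt hlam.le] at h
  have hmain : 2 * √(π * (lam / Lam)) * √(Ain g c) ≤ Lg g c := by
    refine abs_le_of_sq_le_sq' ?_ hL |>.2
    rw [mul_pow, mul_pow, Real.sq_sqrt (by positivity), Real.sq_sqrt hin]
    calc 2 ^ 2 * (π * (lam / Lam)) * Ain g c
        ≤ 2 ^ 2 * (π * (lam / Lam)) * (Lam * (volume c.interiorRegion).toReal) := by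
          gcongr
          exact Ain_le_mul_volume hg c hLam.le hupper
      _ = lam * (4 * π * (volume c.interiorRegion).toReal) := by
          field_simp
          ring
      _ ≤ lam * Le c ^ 2 := by gcongr
      _ ≤ Lg g c ^ 2 := hlen
  refine ⟨hmain, ?_⟩
  have hout : 0 ≤ Lg g c * (1 / Aout g c) :=
    mul_nonneg hL (one_div_nonneg.2 (Aout_nonneg hA c))
  rw [Iratio, mul_add]
  refine le_add_of_le_of_nonneg ?_ hout
  calc 2 * √(π * (lam / Lam)) / √(Ain g c)
      = 2 * √(π * (lam / Lam)) * √(Ain g c) * (1 / Ain g c) := by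
        rw [mul_assoc, mul_one_div, Real.sqrt_div_self, div_eq_mul_inv]
    _ ≤ Lg g c * (1 / Ain g c) := by gcongr
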